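/- arXiv:1312.4009 — 2 statements merged into one kernel-verified Lean document; each statement's English description precedes it below -/
import Mathlib

section
/- The number of knot (4,5)-mosaics is D_{4,5} = 54226. -/
/-- The eleven mosaic tiles `T₀, …, T₁₀`. -/
inductive Tile : Type
  | T0 | T1 | T2 | T3 | T4 | T5 | T6 | T7 | T8 | T9 | T10
  deriving DecidableEq

namespace Tile

/-- Whether the top edge of a tile carries a connection point.
`T0` has no connection points; `T1,…,T6` realize the six unordered pairs of edges
(`T1`: bottom–left, `T2`: bottom–right, `T3`: top–right, `T4`: top–left,
`T5`: left–right, `T6`: top–bottom); `T7,…,T10` have all four. -/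
def top : Tile → Bool
  | .T3 | .T4 | .T6 | .T7 | .T8 | .T9 | .T10 => true
  | _ => false

/-- Whether the bottom edge of a tile carries a connection point. -/
def bottom : Tile → Bool
  | .T1 | .T2 | .T6 | .T7 | .T8 | .T9 | .T10 => true
  | _ => false

/-- Whether the left edge of a tile carries a connection point. -/
def left : Tile → Bool
  | .T1 | .T4 | .T5 | .T7 | .T8 | .T9 | .T10 => true
  | _ => false

/-- Whether the right edge of a tile carries a connection point. -/
def right : Tile → Bool
  | .T2 | .T3 | .T5 | .T7 | .T8 | .T9 | .T10 => true
  | _ => false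

end Tile

/-- An `(m,n)`-mosaic `M : Fin m → Fin n → Tile` (rows indexed top-to-bottom,
columns left-to-right) is suitably connected if any pair of contiguous tiles
have or do not have connection points simultaneously on their common edge. -/
def SuitablyConnected {m n : ℕ} (M : Fin m → Fin n → Tile) : Prop :=
  (∀ (i : Fin m) (j : Fin n) (h : (j : ℕ) + 1 < n),
    (M i j).right = (M i ⟨(j : ℕ) + 1, h⟩).left) ∧
  (∀ (i : Fin m) (j : Fin n) (h : (i : ℕ) + 1 < m),
    (M i j).bottom = (M ⟨(i : ℕ) + 1, h⟩ j).top)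

/-- None of the boundary edges of the mosaic carries a connection point. -/
def BoundaryFree {m n : ℕ} (M : Fin m → Fin n → Tile) : Prop :=
  ∀ (i : Fin m) (j : Fin n),
    ((i : ℕ) = 0 → (M i j).top = false) ∧
    ((i : ℕ) = m - 1 → (M i j).bottom = false) ∧
    ((j : ℕ) = 0 → (M i j).left = false) ∧
    ((j : ℕ) = n - 1 → (M i j).right = false)

/-- A knot `(m,n)`-mosaic is a suitably connected mosaic none of whose boundary
edges has a connection point. -/
def IsKnotMosaic {m n : ℕ} (M : Fin m → Fin n → Tile) : Prop :=
  SuitablyConnected M ∧ BoundaryFree M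

/-- `D m n`, the number of knot `(m,n)`-mosaics. -/
noncomputable def knotMosaicCount (m n : ℕ) : ℕ :=
  Nat.card {M : Fin m → Fin n → Tile // IsKnotMosaic M}

/-- `|Q^{(p,q)}|`, the number of `(p,q)`-quasimosaics (suitably connected
`(p,q)`-mosaics, with connection points allowed on boundary edges). -/
noncomputable def quasimosaicCount (p q : ℕ) : ℕ :=
  Nat.card {M : Fin p → Fin q → Tile // SuitablyConnected M}

/-- A sequence of steps, the step `x` leading from `f x` to `g x`, is a path from `a` to `b`. -/
def IsPath {α β : Type*} (f g : α → β) : {m : ℕ} → (Fin m → α) → β → β → Prop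
  | 0, _, a, b => a = b
  | _ + 1, M, a, b => f (M 0) = a ∧ IsPath f g (Fin.tail M) (g (M 0)) b

theorem isPath_succ_iff {α β : Type*} (f g : α → β) {m : ℕ} (M : Fin (m + 1) → α) (a b : β) :
    IsPath f g M a b ↔ f (M 0) = a ∧ (∀ i : Fin m, g (M i.castSucc) = f (M i.succ)) ∧
      g (M (Fin.last m)) = b := by
  induction m generalizing a with
  | zero => simp [IsPath]
  | succ m ih =>
    rw [IsPath, ih, Fin.forall_fin_succ]
    simp only [Fin.tail, Fin.succ_last, Fin.castSucc_zero, Fin.succ_castSucc]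
    grind

theorem isPath_self_iff {α β : Type*} (f g : α → β) {m : ℕ} (M : Fin m → α) (a : β) :
    IsPath f g M a a ↔
      (∀ (i : Fin m) (h : (i : ℕ) + 1 < m), g (M i) = f (M ⟨(i : ℕ) + 1, h⟩)) ∧
      ∀ i : Fin m, ((i : ℕ) = 0 → f (M i) = a) ∧ ((i : ℕ) = m - 1 → g (M i) = a) := by
  cases m with
  | zero => simp [IsPath]
  | succ m =>
    rw [isPath_succ_iff]
    constructor
    · rintro ⟨h0, hs, hl⟩
      refine ⟨fun i h => hs ⟨i, by omega⟩, fun i => ⟨fun hi => ?_, fun hi => ?_⟩⟩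
      · rwa [show i = 0 from Fin.ext hi]
      · rwa [show i = Fin.last m from Fin.ext hi]
    · rintro ⟨hs, hb⟩
      exact ⟨(hb 0).1 rfl, fun i => hs i.castSucc (by simp), (hb (Fin.last m)).2 (by simp)⟩

/-- The matrix counting the steps satisfying `p` between two given states. -/
noncomputable def stepMatrix {α β : Type*} (f g : α → β) (p : α → Prop) : Matrix β β ℕ :=
  fun a c => Nat.card {x : α // p x ∧ f x = a ∧ g x = c}

/-- A path of length `m + 1` is a first step together with a path of length `m`. -/
def pathSuccEquiv {α β : Type*} (f g : α → β) {m : ℕ} (p : Fin (m + 1) → α → Prop) (a b : β) :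
    {M : Fin (m + 1) → α // (∀ i, p i (M i)) ∧ IsPath f g M a b} ≃
      Σ c, {x : α // p 0 x ∧ f x = a ∧ g x = c} ×
        {M : Fin m → α // (∀ i, p i.succ (M i)) ∧ IsPath f g M c b} where
  toFun M := ⟨g (M.1 0), ⟨M.1 0, M.2.1 0, M.2.2.1, rfl⟩,
    ⟨Fin.tail M.1, fun i => M.2.1 i.succ, M.2.2.2⟩⟩
  invFun y := ⟨Fin.cons y.2.1.1 y.2.2.1, Fin.cases y.2.1.2.1 y.2.2.2.1,
    y.2.1.2.2.1, by simpa [y.2.1.2.2.2] using y.2.2.2.2⟩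
  left_inv M := Subtype.ext (Fin.cons_self_tail M.1)
  right_inv := by
    rintro ⟨c, ⟨x, hp, hf, rfl⟩, M, hM⟩
    rfl

theorem card_isPath {α β : Type*} [Finite α] [Fintype β] [DecidableEq β] (f g : α → β) {m : ℕ}
    (p : Fin m → α → Prop) (a b : β) :
    Nat.card {M : Fin m → α // (∀ i, p i (M i)) ∧ IsPath f g M a b} =
      (List.ofFn fun i => stepMatrix f g (p i)).prod a b := by
  induction m generalizing a with
  | zero =>
    by_cases h : a = b <;> simp [IsPath, h]
  | succ m ih =>
    rw [Nat.card_congr (pathSuccEquiv f g p a b), Nat.card_sigma, List.ofFn_succ, List.prod_cons,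
      Matrix.mul_apply]
    exact Finset.sum_congr rfl fun c _ => by rw [Nat.card_prod, ih]; rfl

instance : Fintype Tile where
  elems := {.T0, .T1, .T2, .T3, .T4, .T5, .T6, .T7, .T8, .T9, .T10}
  complete x := by cases x <;> decide

/-- The number of tiles with prescribed connection points (top, bottom, left, right). -/
def tileMatrix (t b : Bool) : Matrix Bool Bool ℕ := fun l r =>
  if (t ^^ b ^^ l ^^ r) then 0 else if t && b && l && r then 4 else 1

theorem stepMatrix_tile (t b : Bool) :
    stepMatrix Tile.left Tile.right (fun x => x.top = t ∧ x.bottom = b) = tileMatrix t b := by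
  ext l r
  rw [stepMatrix, Nat.card_eq_fintype_card]
  cases t <;> cases b <;> cases l <;> cases r <;> decide

/-- The number of rows of tiles with prescribed connection points on their top and bottom edges,
the left boundary edge given by `l`, and no connection point on the right boundary edge. -/
def rowCount : {n : ℕ} → (Fin n → Bool) → (Fin n → Bool) → Bool → ℕ
  | 0, _, _, l => if l then 0 else 1
  | _ + 1, s, t, l =>
    (if s 0 && t 0 && l then 4 else 1) *
      rowCount (Fin.tail s) (Fin.tail t) (s 0 ^^ t 0 ^^ l)

theorem prod_tileMatrix {n : ℕ} (s t : Fin n → Bool) (l : Bool) :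
    (List.ofFn fun j => tileMatrix (s j) (t j)).prod l false = rowCount s t l := by
  induction n generalizing l with
  | zero => cases l <;> simp [rowCount]
  | succ n ih =>
    rw [List.ofFn_succ, List.prod_cons, Matrix.mul_apply, Fintype.sum_bool]
    have h := ih (Fin.tail s) (Fin.tail t)
    simp only [Fin.tail] at h
    rw [h, h, rowCount]
    cases hs : s 0 <;> cases ht : t 0 <;> cases l <;> simp [tileMatrix]

/-- The number of rows of tiles with prescribed connection points on their top and bottom edges and
none on the left and right boundary. -/
def rowMatrix (n : ℕ) : Matrix (Fin n → Bool) (Fin n → Bool) ℕ :=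
  fun s t => rowCount s t false

/-- A row of tiles all of whose horizontal connections match, closed at both ends. -/
def IsRow {n : ℕ} (R : Fin n → Tile) : Prop := IsPath Tile.left Tile.right R false false

theorem stepMatrix_isRow (n : ℕ) :
    stepMatrix (fun (R : Fin n → Tile) j => (R j).top) (fun R j => (R j).bottom) IsRow =
      rowMatrix n := by
  ext s t
  simp only [rowMatrix, ← prod_tileMatrix, ← stepMatrix_tile]
  rw [← card_isPath]
  refine Nat.card_congr (Equiv.subtypeEquivRight fun R => ?_)
  simp only [IsRow, funext_iff, forall_and]
  tauto

theorem isKnotMosaic_iff {m n : ℕ} (M : Fin m → Fin n → Tile) :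
    IsKnotMosaic M ↔ (∀ i, IsRow (M i)) ∧
      IsPath (fun (R : Fin n → Tile) j => (R j).top) (fun R j => (R j).bottom) M
        (fun _ => false) (fun _ => false) := by
  simp only [IsRow, isPath_self_iff, IsKnotMosaic, SuitablyConnected, BoundaryFree, funext_iff]
  grind

/-- The transfer-matrix formula for the number of knot mosaics. -/
theorem knotMosaicCount_eq_pow (m n : ℕ) :
    knotMosaicCount m n = (rowMatrix n ^ m) (fun _ => false) (fun _ => false) := by
  rw [knotMosaicCount, Nat.card_congr (Equiv.subtypeEquivRight isKnotMosaic_iff),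
    card_isPath _ _ fun _ => IsRow, stepMatrix_isRow, List.ofFn_const, List.prod_replicate]

/-- The number of knot `(4,5)`-mosaics is `D_{4,5} = 54226`. -/
theorem knotMosaicCount_four_five : knotMosaicCount 4 5 = 54226 := by
  rw [knotMosaicCount_eq_pow, show 4 = 2 + 2 from rfl, pow_add, pow_two]
  decide +kernel
end

section
/- For all integers m, n ≥ 3, the number of knot (m,n)-mosaics equals twice the number of (m-2,n-2)-quasimosaics, i.e., D_{m,n} = 2·|Q^{(m-2,n-2)}|. -/
theorem Tile.ext_of_edge_eq_false {s t : Tile} (htop : s.top = t.top)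
    (hbottom : s.bottom = t.bottom) (hleft : s.left = t.left) (hright : s.right = t.right)
    (h : s.top = false ∨ s.bottom = false ∨ s.left = false ∨ s.right = false) : s = t := by
  cases s <;> cases t <;> simp_all [Tile.top, Tile.bottom, Tile.left, Tile.right]

theorem Tile.even_edges (t : Tile) : (t.top ^^ t.bottom) = (t.left ^^ t.right) := by
  cases t <;> rfl

/-- The vertices of the tile are coloured `a`, `b` (top row) and `c`, `d` (bottom row) so that
an edge carries a connection point exactly when its endpoints have different colours. -/
def Tile.Colored (t : Tile) (a b c d : Bool) : Prop :=
  t.top = (a ^^ b) ∧ t.bottom = (c ^^ d) ∧ t.left = (a ^^ c) ∧ t.right = (b ^^ d)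

theorem Tile.exists_colored (a b c d : Bool) : ∃ t : Tile, t.Colored a b c d := by
  have h : ∃ t ∈ [T0, T1, T2, T3, T4, T5, T6, T7],
      t.top = (a ^^ b) ∧ t.bottom = (c ^^ d) ∧ t.left = (a ^^ c) ∧ t.right = (b ^^ d) := by
    revert a b c d
    decide
  obtain ⟨t, -, ht⟩ := h
  exact ⟨t, ht⟩

/-- `c` is a two-colouring of the lattice points of the mosaic `M`: an edge
carries a connection point exactly when its endpoints have different colours. -/
def IsColoring {m n : ℕ} (M : Fin m → Fin n → Tile) (c : ℕ → ℕ → Bool) : Prop :=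
  ∀ (i : Fin m) (j : Fin n),
    (M i j).Colored (c i j) (c i (j + 1)) (c (i + 1) j) (c (i + 1) (j + 1))

theorem IsColoring.suitablyConnected {m n : ℕ} {M : Fin m → Fin n → Tile} {c : ℕ → ℕ → Bool}
    (h : IsColoring M c) : SuitablyConnected M :=
  ⟨fun i j hj ↦ (h i j).2.2.2.trans (h i ⟨j + 1, hj⟩).2.2.1.symm,
    fun i j hi ↦ (h i j).2.1.trans (h ⟨i + 1, hi⟩ j).1.symm⟩

/-- The colouring obtained by starting with colour `b` at the origin, and switching colours
along the first column according to `v` and along each row according to `h`. -/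
def propagateColor (b : Bool) (v : ℕ → Bool) (h : ℕ → ℕ → Bool) : ℕ → ℕ → Bool
  | 0, 0 => b
  | i + 1, 0 => propagateColor b v h i 0 ^^ v i
  | i, j + 1 => propagateColor b v h i j ^^ h i j

theorem SuitablyConnected.exists_isColoring {m n : ℕ} {M : Fin m → Fin n → Tile}
    (hM : SuitablyConnected M) (b : Bool) : ∃ c, IsColoring M c ∧ c 0 0 = b := by
  let N : ℕ → ℕ → Tile := fun i j ↦
    if h : i < m ∧ j < n then M ⟨i, h.1⟩ ⟨j, h.2⟩ else Tile.T0
  have hN (i : Fin m) (j : Fin n) : N i j = M i j := by simp [N]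
  let h : ℕ → ℕ → Bool := fun i j ↦ match i with
    | 0 => (N 0 j).top
    | i + 1 => (N i j).bottom
  let c := propagateColor b (fun i ↦ (N i 0).left) h
  have htop (i j : ℕ) (hi : i < m) (hj : j < n) : h i j = (N i j).top := by
    cases i with
    | zero => rfl
    | succ i =>
      have := hM.2 ⟨i, by omega⟩ ⟨j, hj⟩ hi
      rw [← hN, ← hN] at this
      exact this
  have hrow (i j : ℕ) : c i (j + 1) = (c i j ^^ h i j) := by
    cases i <;> simp [c, propagateColor]
  have hleft (i j : ℕ) (hi : i < m) (hj : j < n) : c (i + 1) j = (c i j ^^ (N i j).left) := by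
    induction j with
    | zero => simp [c, propagateColor]
    | succ j ih =>
      have hs := hM.1 ⟨i, hi⟩ ⟨j, by omega⟩ hj
      rw [← hN, ← hN] at hs
      dsimp only at hs
      have ht := htop i j hi (by omega)
      have he := (N i j).even_edges
      rw [hrow, hrow, ih (by omega), ht, ← hs]
      change (_ ^^ (N i j).bottom) = _
      revert he
      generalize (N i j).top = x1, (N i j).bottom = x2, (N i j).left = x3,
        (N i j).right = x4, c i j = x5
      revert x1 x2 x3 x4 x5
      decide
  refine ⟨c, fun i j ↦ ?_, by simp [c, propagateColor]⟩
  have he := (N i j).even_edges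
  have h1 := hrow i j
  have h2 := hrow (i + 1) j
  have h3 := hleft i j i.2 j.2
  rw [htop i j i.2 j.2] at h1
  change _ = (_ ^^ (N i j).bottom) at h2
  rw [Tile.Colored, ← hN, h2, h1, h3]
  revert he
  generalize (N i j).top = x1, (N i j).bottom = x2, (N i j).left = x3,
    (N i j).right = x4, c i j = x5
  revert x1 x2 x3 x4 x5
  decide

theorem IsColoring.eq {m n : ℕ} {M : Fin m → Fin n → Tile} {c d : ℕ → ℕ → Bool}
    (hc : IsColoring M c) (hd : IsColoring M d) (hm : 0 < m) (hn : 0 < n)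
    (h0 : c 0 0 = d 0 0) {i j : ℕ} (hi : i ≤ m) (hj : j ≤ n) : c i j = d i j := by
  induction j with
  | zero =>
    induction i with
    | zero => exact h0
    | succ i ih =>
      have h := (hc ⟨i, hi⟩ ⟨0, hn⟩).2.2.1.symm.trans (hd ⟨i, hi⟩ ⟨0, hn⟩).2.2.1
      dsimp only at h
      rw [ih (by omega)] at h
      exact Bool.xor_right_inj.1 h
  | succ j ih =>
    specialize ih (by omega)
    rcases hi.lt_or_eq with hi | rfl
    · have h := (hc ⟨i, hi⟩ ⟨j, hj⟩).1.symm.trans (hd ⟨i, hi⟩ ⟨j, hj⟩).1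
      dsimp only at h
      rw [ih] at h
      exact Bool.xor_right_inj.1 h
    · obtain ⟨i, rfl⟩ := Nat.exists_eq_succ_of_ne_zero hm.ne'
      have h := (hc ⟨i, by omega⟩ ⟨j, hj⟩).2.1.symm.trans (hd ⟨i, by omega⟩ ⟨j, hj⟩).2.1
      dsimp only at h
      rw [ih] at h
      exact Bool.xor_right_inj.1 h

theorem IsColoring.eq_false_of_boundary {m n : ℕ} {M : Fin m → Fin n → Tile} {c : ℕ → ℕ → Bool}
    (hc : IsColoring M c) (hM : BoundaryFree M) (hm : 0 < m) (hn : 0 < n) (h0 : c 0 0 = false)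
    {i j : ℕ} (hi : i ≤ m) (hj : j ≤ n) (hij : i = 0 ∨ i = m ∨ j = 0 ∨ j = n) :
    c i j = false := by
  obtain ⟨m, rfl⟩ := Nat.exists_eq_succ_of_ne_zero hm.ne'
  obtain ⟨n, rfl⟩ := Nat.exists_eq_succ_of_ne_zero hn.ne'
  have top (j : ℕ) (hj : j ≤ n + 1) : c 0 j = false := by
    induction j with
    | zero => exact h0
    | succ j ih =>
      have h := (hc ⟨0, hm⟩ ⟨j, hj⟩).1.symm.trans ((hM ⟨0, hm⟩ ⟨j, hj⟩).1 rfl)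
      simpa [ih (by omega)] using h
  have left (i : ℕ) (hi : i ≤ m + 1) : c i 0 = false := by
    induction i with
    | zero => exact h0
    | succ i ih =>
      have h := (hc ⟨i, hi⟩ ⟨0, hn⟩).2.2.1.symm.trans ((hM ⟨i, hi⟩ ⟨0, hn⟩).2.2.1 rfl)
      simpa [ih (by omega)] using h
  have bottom (j : ℕ) (hj : j ≤ n + 1) : c (m + 1) j = false := by
    induction j with
    | zero => exact left _ le_rfl
    | succ j ih =>
      have h := (hc ⟨m, by omega⟩ ⟨j, hj⟩).2.1.symm.trans
        ((hM ⟨m, by omega⟩ ⟨j, hj⟩).2.1 rfl)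
      simpa [ih (by omega)] using h
  have right (i : ℕ) (hi : i ≤ m + 1) : c i (n + 1) = false := by
    induction i with
    | zero => exact top _ le_rfl
    | succ i ih =>
      have h := (hc ⟨i, hi⟩ ⟨n, by omega⟩).2.2.2.symm.trans
        ((hM ⟨i, hi⟩ ⟨n, by omega⟩).2.2.2 rfl)
      simpa [ih (by omega)] using h
  rcases hij with rfl | rfl | rfl | rfl
  exacts [top j hj, bottom j hj, left i hi, right i hi]

/-- The mosaic obtained by removing the outermost rows and columns. -/
def innerMosaic {p q : ℕ} (M : Fin (p + 2) → Fin (q + 2) → Tile) (i : Fin p) (j : Fin q) : Tile :=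
  M ⟨i + 1, by omega⟩ ⟨j + 1, by omega⟩

theorem IsColoring.isColoring_innerMosaic {p q : ℕ} {M : Fin (p + 2) → Fin (q + 2) → Tile}
    {c : ℕ → ℕ → Bool} (hc : IsColoring M c) :
    IsColoring (innerMosaic M) fun i j ↦ c (i + 1) (j + 1) :=
  fun i j ↦ hc ⟨i + 1, by omega⟩ ⟨j + 1, by omega⟩

theorem SuitablyConnected.suitablyConnected_innerMosaic {p q : ℕ}
    {M : Fin (p + 2) → Fin (q + 2) → Tile}
    (hM : SuitablyConnected M) : SuitablyConnected (innerMosaic M) :=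
  ⟨fun i j _ ↦ hM.1 ⟨i + 1, by omega⟩ ⟨j + 1, by omega⟩ (by dsimp only; omega),
    fun i j _ ↦ hM.2 ⟨i + 1, by omega⟩ ⟨j + 1, by omega⟩ (by dsimp only; omega)⟩

theorem IsKnotMosaic.eq_of_innerMosaic_eq {p q : ℕ} (hp : 0 < p) (hq : 0 < q)
    {M N : Fin (p + 2) → Fin (q + 2) → Tile} (hM : IsKnotMosaic M) (hN : IsKnotMosaic N)
    (hinner : innerMosaic M = innerMosaic N) (hcorner : (M 0 0).right = (N 0 0).right) :
    M = N := by
  obtain ⟨c, hc, hc0⟩ := hM.1.exists_isColoring false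
  obtain ⟨d, hd, hd0⟩ := hN.1.exists_isColoring false
  have hcb {i j : ℕ} (hi : i ≤ p + 2) (hj : j ≤ q + 2) :=
    hc.eq_false_of_boundary hM.2 (by omega) (by omega) hc0 hi hj
  have hdb {i j : ℕ} (hi : i ≤ p + 2) (hj : j ≤ q + 2) :=
    hd.eq_false_of_boundary hN.2 (by omega) (by omega) hd0 hi hj
  have h11 : c 1 1 = d 1 1 := by
    have h := (hc 0 0).2.2.2.symm.trans (hcorner.trans (hd 0 0).2.2.2)
    simpa [hcb (i := 0) (j := 1) (by omega) (by omega) (by omega),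
      hdb (i := 0) (j := 1) (by omega) (by omega) (by omega)] using h
  have hcd (i j : ℕ) (hi : i ≤ p + 2) (hj : j ≤ q + 2) : c i j = d i j := by
    by_cases hij : i = 0 ∨ i = p + 2 ∨ j = 0 ∨ j = q + 2
    · rw [hcb hi hj hij, hdb hi hj hij]
    · obtain ⟨i, rfl⟩ := Nat.exists_eq_succ_of_ne_zero (n := i) (by omega)
      obtain ⟨j, rfl⟩ := Nat.exists_eq_succ_of_ne_zero (n := j) (by omega)
      exact hc.isColoring_innerMosaic.eq (hinner ▸ hd.isColoring_innerMosaic) hp hq h11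
        (i := i) (j := j) (by omega) (by omega)
  funext i j
  by_cases hij : (i : ℕ) = 0 ∨ (i : ℕ) = p + 1 ∨ (j : ℕ) = 0 ∨ (j : ℕ) = q + 1
  · have hcol := hc i j
    rw [hcd i j (by omega) (by omega), hcd i (j + 1) (by omega) (by omega),
      hcd (i + 1) j (by omega) (by omega), hcd (i + 1) (j + 1) (by omega) (by omega)] at hcol
    obtain ⟨c1, c2, c3, c4⟩ := hcol
    obtain ⟨d1, d2, d3, d4⟩ := hd i j
    obtain ⟨h1, h2, h3, h4⟩ := hM.2 i j
    exact Tile.ext_of_edge_eq_false (c1.trans d1.symm) (c2.trans d2.symm) (c3.trans d3.symm)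
      (c4.trans d4.symm) (hij.imp h1 (Or.imp h2 (Or.imp h3 h4)))
  · have h := congr_fun₂ hinner ⟨i - 1, by omega⟩ ⟨j - 1, by omega⟩
    have hi : (i : ℕ) - 1 + 1 = i := by omega
    have hj : (j : ℕ) - 1 + 1 = j := by omega
    simpa only [innerMosaic, hi, hj] using h

theorem SuitablyConnected.exists_isKnotMosaic {p q : ℕ} {M : Fin p → Fin q → Tile}
    (hM : SuitablyConnected M) (b : Bool) :
    ∃ N : Fin (p + 2) → Fin (q + 2) → Tile,
      IsKnotMosaic N ∧ innerMosaic N = M ∧ (N 0 0).right = b := by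
  obtain ⟨c, hc, hc0⟩ := hM.exists_isColoring b
  let d : ℕ → ℕ → Bool := fun i j ↦
    if 0 < i ∧ i < p + 2 ∧ 0 < j ∧ j < q + 2 then c (i - 1) (j - 1) else false
  have hd (i j : ℕ) (hij : i = 0 ∨ i = p + 2 ∨ j = 0 ∨ j = q + 2) : d i j = false :=
    if_neg (by omega)
  have hdc (i j : ℕ) (hi : i ≤ p) (hj : j ≤ q) : d (i + 1) (j + 1) = c i j :=
    if_pos (by omega)
  have hex (i : Fin (p + 2)) (j : Fin (q + 2)) : ∃ t : Tile,
      t.Colored (d i j) (d i (j + 1)) (d (i + 1) j) (d (i + 1) (j + 1)) ∧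
      ∀ (i' : Fin p) (j' : Fin q), (i : ℕ) = i' + 1 → (j : ℕ) = j' + 1 → t = M i' j' := by
    by_cases hij : ∃ (i' : Fin p) (j' : Fin q), (i : ℕ) = i' + 1 ∧ (j : ℕ) = j' + 1
    · obtain ⟨i', j', hi, hj⟩ := hij
      refine ⟨M i' j', ?_, fun i'' j'' hi' hj' ↦ ?_⟩
      · rw [hi, hj, hdc _ _ (by omega) (by omega), hdc _ _ (by omega) (by omega),
          hdc _ _ (by omega) (by omega), hdc _ _ (by omega) (by omega)]
        exact hc i' j'
      · congr 1 <;> ext <;> omega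
    · obtain ⟨t, ht⟩ := Tile.exists_colored (d i j) (d i (j + 1)) (d (i + 1) j) (d (i + 1) (j + 1))
      exact ⟨t, ht, fun i' j' hi hj ↦ (hij ⟨i', j', hi, hj⟩).elim⟩
  choose N hN hNM using hex
  refine ⟨N, ⟨IsColoring.suitablyConnected hN, fun i j ↦ ?_⟩, ?_, ?_⟩
  · obtain ⟨h1, h2, h3, h4⟩ := hN i j
    refine ⟨fun h ↦ ?_, fun h ↦ ?_, fun h ↦ ?_, fun h ↦ ?_⟩
    · rw [h1, hd _ _ (by omega), hd _ _ (by omega), Bool.xor_self]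
    · rw [h2, hd _ _ (by omega), hd _ _ (by omega), Bool.xor_self]
    · rw [h3, hd _ _ (by omega), hd _ _ (by omega), Bool.xor_self]
    · rw [h4, hd _ _ (by omega), hd _ _ (by omega), Bool.xor_self]
  · funext i j
    exact hNM _ _ i j rfl rfl
  · have h := (hN 0 0).2.2.2
    have h01 := hd 0 1 (by omega)
    have h11 := hdc 0 0 (by omega) (by omega)
    simp_all

/-- For all integers `m, n ≥ 3`, `D_{m,n} = 2·|Q^{(m-2,n-2)}|`. -/
theorem knotMosaicCount_eq_two_mul_quasimosaicCount (m n : ℕ)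
    (hm : 3 ≤ m) (hn : 3 ≤ n) :
    knotMosaicCount m n = 2 * quasimosaicCount (m - 2) (n - 2) := by
  obtain ⟨p, rfl⟩ := Nat.exists_eq_add_of_le' (show 2 ≤ m by omega)
  obtain ⟨q, rfl⟩ := Nat.exists_eq_add_of_le' (show 2 ≤ n by omega)
  rw [Nat.add_sub_cancel, Nat.add_sub_cancel, knotMosaicCount, quasimosaicCount]
  have hbool : Nat.card Bool = 2 := by simp
  refine (?_ : _ = _).trans ((Nat.card_prod Bool _).trans (congrArg (· * _) hbool))
  refine Nat.card_eq_of_bijective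
    (fun M ↦ ((M.1 0 0).right, ⟨innerMosaic M.1, M.2.1.suitablyConnected_innerMosaic⟩)) ⟨?_, ?_⟩
  · rintro ⟨M, hM⟩ ⟨N, hN⟩ h
    simp only [Prod.mk.injEq, Subtype.mk.injEq] at h
    exact Subtype.ext (hM.eq_of_innerMosaic_eq (by omega) (by omega) hN h.2 h.1)
  · rintro ⟨b, M, hM⟩
    obtain ⟨N, hN, rfl, rfl⟩ := hM.exists_isKnotMosaic b
    exact ⟨⟨N, hN⟩, rfl⟩
end
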